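/- Let S ⊆ ℝ² be a finite set whose convex hull P = convexHull ℝ S has nonempty interior, and let u ∈ ℝ² be a nonzero vector. Suppose G is a parallelogram with center z and spanning vectors v, w, S-anchored to u, with P ⊆ G, whose area is minimal among all parallelograms that are S-anchored to u and contain P. Then there exist A, B, C, D ∈ P with C − A a scalar multiple of u such that A ∈ a, B ∈ b, C ∈ c, D ∈ d, where a, b, c, d are the sides of G (i.e., G admits a conjugate quadrilateral contained in P). -/

import Mathlib

open MeasureTheory

/-- The parallelogram with center `z` and spanning vectors `v`, `w`:
the set `{z + s•v + t•w : s, t ∈ [−1, 1]}`. -/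
def Pgram (z v w : ℝ × ℝ) : Set (ℝ × ℝ) :=
  {x | ∃ s t : ℝ, s ∈ Set.Icc (-1 : ℝ) 1 ∧ t ∈ Set.Icc (-1 : ℝ) 1 ∧ x = z + s • v + t • w}

/-- Side `a` of the parallelogram. -/
def sideA (z v w : ℝ × ℝ) : Set (ℝ × ℝ) := segment ℝ (z - v - w) (z - v + w)

/-- Side `b` of the parallelogram. -/
def sideB (z v w : ℝ × ℝ) : Set (ℝ × ℝ) := segment ℝ (z - v + w) (z + v + w)

/-- Side `c` of the parallelogram. -/
def sideC (z v w : ℝ × ℝ) : Set (ℝ × ℝ) := segment ℝ (z + v - w) (z + v + w)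

/-- Side `d` of the parallelogram. -/
def sideD (z v w : ℝ × ℝ) : Set (ℝ × ℝ) := segment ℝ (z - v - w) (z + v - w)

open MeasureTheory Filter Topology

def crossDet (v w : ℝ × ℝ) : ℝ := v.1 * w.2 - v.2 * w.1

lemma linInd_iff (v w : ℝ × ℝ) : LinearIndependent ℝ ![v, w] ↔ crossDet v w ≠ 0 := by
  rw [LinearIndependent.pair_iff]
  unfold crossDet
  obtain ⟨a, b⟩ := v
  obtain ⟨c, d⟩ := w
  simp only [Prod.smul_mk, Prod.mk_add_mk, Prod.mk_eq_zero, smul_eq_mul]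
  constructor
  · intro h h0
    have h1 := h d (-b) ⟨by linarith, by ring⟩
    have h2 := h c (-a) ⟨by ring, by linarith⟩
    have h3 := h 1 0 ⟨by linarith [h2.2], by linarith [h1.2]⟩
    exact one_ne_zero h3.1
  · intro h s t ⟨h1, h2⟩
    constructor
    · apply (mul_eq_zero.1 (_ : s * (a * d - b * c) = 0)).resolve_right h
      linear_combination d * h1 - c * h2
    · apply (mul_eq_zero.1 (_ : t * (a * d - b * c) = 0)).resolve_right h
      linear_combination a * h2 - b * h1

def spanMap (v w : ℝ × ℝ) : (ℝ × ℝ) →ₗ[ℝ] (ℝ × ℝ) :=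
  (LinearMap.fst ℝ ℝ ℝ).smulRight v + (LinearMap.snd ℝ ℝ ℝ).smulRight w

lemma spanMap_apply (v w p : ℝ × ℝ) : spanMap v w p = p.1 • v + p.2 • w := by
  simp [spanMap]

lemma spanMap_det (v w : ℝ × ℝ) : LinearMap.det (spanMap v w) = crossDet v w := by
  rw [← LinearMap.det_toMatrix (Module.Basis.finTwoProd ℝ), Matrix.det_fin_two]
  simp [LinearMap.toMatrix_apply, spanMap, crossDet]
  ring

def unitSq : Set (ℝ × ℝ) := Set.Icc (-1 : ℝ) 1 ×ˢ Set.Icc (-1 : ℝ) 1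

lemma pgram_eq (z v w : ℝ × ℝ) :
    Pgram z v w = (fun x => z + x) '' (spanMap v w '' unitSq) := by
  ext x
  constructor
  · rintro ⟨s, t, hs, ht, rfl⟩
    exact ⟨_, ⟨(s, t), ⟨hs, ht⟩, rfl⟩, by simp only [spanMap_apply, add_assoc]⟩
  · rintro ⟨_, ⟨⟨s, t⟩, ⟨hs, ht⟩, rfl⟩, rfl⟩
    exact ⟨s, t, hs, ht, by simp only [spanMap_apply, add_assoc]⟩

lemma pgram_convex (z v w : ℝ × ℝ) : Convex ℝ (Pgram z v w) := by
  rw [pgram_eq]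
  exact (((convex_Icc _ _).prod (convex_Icc _ _)).linear_image _).translate z

lemma pgram_volume (z v w : ℝ × ℝ) :
    volume (Pgram z v w) = ENNReal.ofReal (4 * |crossDet v w|) := by
  rw [pgram_eq, Set.image_add_left, measure_preimage_add, Measure.addHaar_image_linearMap,
    spanMap_det]
  unfold unitSq
  rw [Measure.volume_eq_prod, Measure.prod_prod, Real.volume_Icc,
    ← ENNReal.ofReal_mul (by norm_num), ← ENNReal.ofReal_mul (by positivity)]
  congr 1
  ring

lemma exists_bound {S : Set (ℝ × ℝ)} (hS : S.Finite) (f : ℝ × ℝ → ℝ) (hf : ∀ x ∈ S, f x < 1) :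
    ∃ δ : ℝ, 0 < δ ∧ δ < 1 ∧ ∀ x ∈ S, f x ≤ δ := by
  have h1 : ∀ᶠ δ : ℝ in 𝓝[<] 1, ∀ x ∈ S, f x ≤ δ := by
    rw [eventually_all_finite hS]
    intro x hx
    exact nhdsWithin_le_nhds ((lt_mem_nhds (hf x hx)).mono fun _ h => le_of_lt h)
  have h2 : ∀ᶠ δ : ℝ in 𝓝[<] 1, 0 < δ := nhdsWithin_le_nhds (lt_mem_nhds one_pos)
  have h3 : ∀ᶠ δ : ℝ in 𝓝[<] 1, δ < 1 := self_mem_nhdsWithin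
  obtain ⟨δ, a, b, c⟩ := (h2.and (h3.and h1)).exists
  exact ⟨δ, a, b, c⟩

/-- If `a ≤ 1` and `k < 0` whenever `a = 1`, small positive perturbations are below one. -/
lemma eventually_perturb (a k : ℝ) (ha : a ≤ 1) (hk : a = 1 → k < 0) :
    ∀ᶠ ε : ℝ in 𝓝[>] 0, a + ε * k < 1 := by
  rcases ha.lt_or_eq with h | h
  · have hc : Tendsto (fun ε : ℝ => a + ε * k) (𝓝 0) (𝓝 (a + 0 * k)) :=
      (by fun_prop : Continuous fun ε : ℝ => a + ε * k).tendsto 0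
    exact nhdsWithin_le_nhds (hc.eventually (gt_mem_nhds (by simpa using h)))
  · filter_upwards [self_mem_nhdsWithin] with ε hε
    have := mul_neg_of_pos_of_neg (show 0 < ε from hε) (hk h)
    linarith

lemma side_mem (p q x : ℝ × ℝ) (s : ℝ) (hs : s ∈ Set.Icc (-1 : ℝ) 1)
    (hx : x = ((1 - s) / 2) • p + ((1 + s) / 2) • q) : x ∈ segment ℝ p q :=
  ⟨(1 - s) / 2, (1 + s) / 2, by linarith [hs.2], by linarith [hs.1], by ring, hx.symm⟩

/-- If `G` is a smallest parallelogram S-anchored to `u` enclosing the convex hull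
`P` of a finite set (with nonempty interior), then there is a quadrilateral contained in `P`
that is conjugate to `G`. -/
theorem smallest_anchored_parallelogram_has_conjugate_quadrilateral
    (S : Set (ℝ × ℝ)) (hS : S.Finite)
    (hint : (interior (convexHull ℝ S)).Nonempty)
    (u : ℝ × ℝ) (hu : u ≠ 0)
    (z v w : ℝ × ℝ) (hvw : LinearIndependent ℝ ![v, w])
    (hanch : ∃ r : ℝ, r ≠ 0 ∧ v = r • u)
    (hPG : convexHull ℝ S ⊆ Pgram z v w)
    (hmin : ∀ z' v' w' : ℝ × ℝ, LinearIndependent ℝ ![v', w'] →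
      (∃ r : ℝ, r ≠ 0 ∧ v' = r • u) → convexHull ℝ S ⊆ Pgram z' v' w' →
      volume (Pgram z v w) ≤ volume (Pgram z' v' w')) :
    ∃ A B C D : ℝ × ℝ, A ∈ convexHull ℝ S ∧ B ∈ convexHull ℝ S ∧
      C ∈ convexHull ℝ S ∧ D ∈ convexHull ℝ S ∧ (∃ t : ℝ, C - A = t • u) ∧
      A ∈ sideA z v w ∧ B ∈ sideB z v w ∧ C ∈ sideC z v w ∧ D ∈ sideD z v w := by
  have hd : crossDet v w ≠ 0 := (linInd_iff v w).1 hvw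
  obtain ⟨r, hr, hvr⟩ := hanch
  -- coordinates with respect to `v`, `w`
  obtain ⟨σ, hσ⟩ : ∃ σ : (ℝ × ℝ) →ₗ[ℝ] ℝ, ∀ x, σ x = (x.1 * w.2 - x.2 * w.1) / crossDet v w :=
    ⟨(crossDet v w)⁻¹ • (w.2 • LinearMap.fst ℝ ℝ ℝ - w.1 • LinearMap.snd ℝ ℝ ℝ), fun x => by
      simp; field_simp⟩
  obtain ⟨τ, hτ⟩ : ∃ τ : (ℝ × ℝ) →ₗ[ℝ] ℝ, ∀ x, τ x = (v.1 * x.2 - v.2 * x.1) / crossDet v w :=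
    ⟨(crossDet v w)⁻¹ • (v.1 • LinearMap.snd ℝ ℝ ℝ - v.2 • LinearMap.fst ℝ ℝ ℝ), fun x => by
      simp; field_simp⟩
  have σv : σ v = 1 := by
    rw [hσ, div_eq_one_iff_eq hd]; unfold crossDet; ring
  have σw : σ w = 0 := by
    rw [hσ]; simp; left; ring
  have τv : τ v = 0 := by
    rw [hτ]; simp; left; ring
  have τw : τ w = 1 := by
    rw [hτ, div_eq_one_iff_eq hd]; unfold crossDet; ring
  have hcoord : ∀ x ∈ convexHull ℝ S, (σ x - σ z) ∈ Set.Icc (-1 : ℝ) 1 ∧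
      (τ x - τ z) ∈ Set.Icc (-1 : ℝ) 1 ∧ x = z + (σ x - σ z) • v + (τ x - τ z) • w := by
    intro x hx
    obtain ⟨s, t, hs, ht, rfl⟩ := hPG hx
    have e1 : σ (z + s • v + t • w) - σ z = s := by simp [σv, σw]
    have e2 : τ (z + s • v + t • w) - τ z = t := by simp [τv, τw]
    rw [e1, e2]
    exact ⟨hs, ht, rfl⟩
  have hsub : S ⊆ convexHull ℝ S := subset_convexHull ℝ S
  -- no strictly smaller parallelogram
  have key : ∀ (z' : ℝ × ℝ) (α β γ : ℝ), 0 < α → 0 < β → α * β < 1 →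
      (∀ x ∈ S, x ∈ Pgram z' (α • v) (β • w + γ • v)) → False := by
    intro z' α β γ hα hβ hαβ hx
    have hdet : crossDet (α • v) (β • w + γ • v) = (α * β) * crossDet v w := by
      simp [crossDet]; ring
    have h := hmin z' (α • v) (β • w + γ • v)
      ((linInd_iff _ _).2 (by rw [hdet]; positivity))
      ⟨α * r, by positivity, by rw [hvr, smul_smul]⟩
      (convexHull_min hx (pgram_convex _ _ _))
    rw [pgram_volume, pgram_volume, hdet, abs_mul, abs_of_pos (by positivity : 0 < α * β),
      ENNReal.ofReal_le_ofReal_iff (by positivity)] at h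
    have := abs_pos.2 hd
    nlinarith
  -- existence of B, D
  have hBD : ∀ e : ℝ, (e = 1 ∨ e = -1) → ∃ B ∈ convexHull ℝ S, e * (τ B - τ z) = 1 := by
    intro e he
    by_contra! hno
    have hee : e * e = 1 := by rcases he with rfl | rfl <;> norm_num
    have hlt : ∀ x ∈ S, e * (τ x - τ z) < 1 := by
      intro x hx
      refine lt_of_le_of_ne ?_ (hno x (hsub hx))
      obtain ⟨-, ⟨h1, h2⟩, -⟩ := hcoord x (hsub hx)
      rcases he with rfl | rfl <;> linarith
    obtain ⟨δ, hδ0, hδ1, hδ⟩ := exists_bound hS _ hlt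
    refine key (z - (e * (1 - δ) / 2) • w) 1 ((1 + δ) / 2) 0 one_pos (by linarith)
      (by linarith) ?_
    intro x hx
    obtain ⟨h0, ⟨h1, h2⟩, h3⟩ := hcoord x (hsub hx)
    have h4 := hδ x hx
    have hp : (0 : ℝ) < (1 + δ) / 2 := by linarith
    refine ⟨σ x - σ z, (τ x - τ z + e * (1 - δ) / 2) / ((1 + δ) / 2), h0, ⟨?_, ?_⟩, ?_⟩
    · rw [le_div_iff₀ hp]
      rcases he with rfl | rfl <;> linarith
    · rw [div_le_iff₀ hp]
      rcases he with rfl | rfl <;> linarith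
    · rw [one_smul, zero_smul, add_zero, smul_smul, div_mul_cancel₀ _ hp.ne']
      conv_lhs => rw [h3]
      module
  obtain ⟨B, hB, hB1⟩ := hBD 1 (Or.inl rfl)
  obtain ⟨D, hD, hD1⟩ := hBD (-1) (Or.inr rfl)
  -- existence of A, C
  have hAC : ∃ A ∈ convexHull ℝ S, ∃ C ∈ convexHull ℝ S,
      σ A - σ z = -1 ∧ σ C - σ z = 1 ∧ τ A = τ C := by
    by_contra! hno
    have hσc : Continuous σ := σ.continuous_of_finiteDimensional
    have hτc : Continuous τ := τ.continuous_of_finiteDimensional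
    have hcv : ∀ c : ℝ, Convex ℝ (τ '' (convexHull ℝ S ∩ {x | σ x = c})) := fun c =>
      ((convex_convexHull ℝ S).inter (convex_hyperplane σ.isLinear c)).linear_image τ
    have hcp : ∀ c : ℝ, IsCompact (τ '' (convexHull ℝ S ∩ {x | σ x = c})) := fun c =>
      ((hS.isCompact_convexHull ℝ).inter_right (isClosed_eq hσc continuous_const)).image hτc
    obtain ⟨f, a, b, hfa, hab, hfb⟩ := geometric_hahn_banach_compact_closed (hcv (σ z + 1))
      (hcp (σ z + 1)) (hcv (σ z - 1)) (hcp (σ z - 1)).isClosed (by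
        rw [Set.disjoint_left]
        rintro _ ⟨C, ⟨hC, hC1⟩, rfl⟩ ⟨A, ⟨hA, hA1⟩, hE⟩
        simp only [Set.mem_ofPred_eq] at hC1 hA1
        exact hno A hA C hC (by linarith) (by linarith) hE)
    have hf : ∀ t : ℝ, f t = t * f 1 := fun t => by
      conv_lhs => rw [show t = t • (1 : ℝ) by simp, map_smul, smul_eq_mul]
    have e1 : ∀ᶠ ε : ℝ in 𝓝[>] 0, ∀ x ∈ S, (σ x - σ z) + ε * (f (τ x) - a) < 1 := by
      rw [eventually_all_finite hS]
      intro x hx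
      refine eventually_perturb _ _ (hcoord x (hsub hx)).1.2 fun h => ?_
      have := hfa (τ x) ⟨x, ⟨hsub hx, by simp only [Set.mem_ofPred_eq]; linarith⟩, rfl⟩
      linarith
    have e2 : ∀ᶠ ε : ℝ in 𝓝[>] 0, ∀ x ∈ S, -(σ x - σ z) + ε * -(f (τ x) - a) < 1 := by
      rw [eventually_all_finite hS]
      intro x hx
      refine eventually_perturb _ _ (by linarith [(hcoord x (hsub hx)).1.1]) fun h => ?_
      have := hfb (τ x) ⟨x, ⟨hsub hx, by simp only [Set.mem_ofPred_eq]; linarith⟩, rfl⟩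
      linarith
    obtain ⟨ε, h1, h2⟩ := (e1.and e2).exists
    obtain ⟨δ, hδ0, hδ1, hδ⟩ := exists_bound hS
      (fun x => |(σ x - σ z) + ε * (f (τ x) - a)|) (fun x hx => by
        rw [abs_lt]
        exact ⟨by linarith [h2 x hx], h1 x hx⟩)
    refine key (z + (ε * (a - f (τ z))) • v) δ 1 (-(ε * f 1)) hδ0 one_pos (by linarith) ?_
    intro x hx
    obtain ⟨-, h0, h3⟩ := hcoord x (hsub hx)
    have h4 := abs_le.1 (hδ x hx)
    refine ⟨((σ x - σ z) + ε * (f (τ x) - a)) / δ, τ x - τ z, ⟨?_, ?_⟩, h0, ?_⟩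
    · rw [le_div_iff₀ hδ0]; linarith
    · rw [div_le_iff₀ hδ0]; linarith
    · rw [smul_smul, div_mul_cancel₀ _ hδ0.ne', hf (τ x), hf (τ z)]
      conv_lhs => rw [h3]
      module
  obtain ⟨A, hA, C, hC, hA1, hC1, hAC⟩ := hAC
  obtain ⟨-, At, Ae⟩ := hcoord A hA
  obtain ⟨-, Ct, Ce⟩ := hcoord C hC
  obtain ⟨Bs, -, Be⟩ := hcoord B hB
  obtain ⟨Ds, -, De⟩ := hcoord D hD
  rw [hA1] at Ae
  rw [hC1] at Ce
  rw [show τ B - τ z = 1 by linarith] at Be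
  rw [show τ D - τ z = -1 by linarith] at De
  refine ⟨A, B, C, D, hA, hB, hC, hD, ⟨2 * r, ?_⟩, side_mem _ _ _ _ At ?_,
    side_mem _ _ _ _ Bs ?_, side_mem _ _ _ _ Ct ?_, side_mem _ _ _ _ Ds ?_⟩
  · rw [mul_smul, ← hvr, Ae, Ce, ← hAC]
    generalize τ A - τ z = q
    module
  · conv_lhs => rw [Ae]
    module
  · conv_lhs => rw [Be]
    module
  · conv_lhs => rw [Ce]
    module
  · conv_lhs => rw [De]
    module
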